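/- Let h be a trace-free symmetric two-tensor on ℝ^n_+ which is smooth and compactly supported, and let V be a smooth vector field on ℝ^n_+ satisfying: (a) Σ_{k=1}^n ∂_k [ u^{2n/(n−2)} ( h_{ik} − ∂_i V_k − ∂_k V_i + (2/n)(div V) δ_{ik} ) ] = 0 on ℝ^n_+ for all i; and (b) V_n(x) = 0 and ∂_n V_i(x) = h_{in}(x) for all x ∈ ∂ℝ^n_+ and i ∈ {1,…,n−1}. Define the reflections Ṽ and h̃ on ℝ^n by: Ṽ_i(x', x_n) = Ṽ_i(x', −x_n) = V_i(x', x_n) for i ∈ {1,…,n−1}, Ṽ_n(x', x_n) = −Ṽ_n(x', −x_n) = V_n(x', x_n); h̃_{ik}(x', x_n) = h̃_{ik}(x', −x_n) = h_{ik}(x', x_n) for i,k ∈ {1,…,n−1}, h̃_{in}(x', x_n) = −h̃_{in}(x', −x_n) = h_{in}(x', x_n), h̃_{ni}(x', x_n) = −h̃_{ni}(x', −x_n) = h_{ni}(x', x_n) for i ∈ {1,…,n−1}, and h̃_{nn}(x', x_n) = h̃_{nn}(x', −x_n) = h_{nn}(x', x_n), for all (x', x_n) with x_n ≥ 0. Then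 for every smooth compactly supported vector field W̃ on ℝ^n: ∫_{ℝ^n} u^{2n/(n−2)} Σ_{i,k=1}^n ( h̃_{ik} − ∂_i Ṽ_k − ∂_k Ṽ_i + (2/n)(div Ṽ) δ_{ik} ) ∂_k W̃_i dx = 0. -/

import Mathlib

noncomputable section

open MeasureTheory Metric

/-- Euclidean space `ℝ^n`. -/
abbrev Euc (n : ℕ) := EuclideanSpace ℝ (Fin n)

/-- Partial derivative in the `i`-th coordinate direction. -/
def pd {n : ℕ} (i : Fin n) (f : Euc n → ℝ) : Euc n → ℝ :=
  fun x => fderiv ℝ f x (EuclideanSpace.single i 1)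

/-- Kronecker delta. -/
def kd {n : ℕ} (i k : Fin n) : ℝ := if i = k then 1 else 0

/-- `u(x) = (1/(1+|x|²))^{(n-2)/2}`. -/
def u0 (n : ℕ) : Euc n → ℝ :=
  fun x => (1 / (1 + ‖x‖ ^ 2)) ^ (((n : ℝ) - 2) / 2)

/-- Reflection across the hyperplane `{x_l = 0}`. -/
def reflect {n : ℕ} (l : Fin n) (x : Euc n) : Euc n :=
  WithLp.toLp 2 (fun j => if j = l then -x j else x j)

/-- The sign picked up by the `j`-th coordinate under `reflect l`. -/
def reflectSign {n : ℕ} (l j : Fin n) : ℝ := if j = l then -1 else 1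

lemma reflectSign_mul_self {n : ℕ} (l j : Fin n) : reflectSign l j * reflectSign l j = 1 := by
  unfold reflectSign; split_ifs <;> norm_num

/-- `reflect l` as a linear isometry equivalence. -/
def reflectEquiv {n : ℕ} (l : Fin n) : Euc n ≃ₗᵢ[ℝ] Euc n :=
  LinearIsometryEquiv.piLpCongrRight 2
    (fun j => if j = l then LinearIsometryEquiv.neg ℝ else LinearIsometryEquiv.refl ℝ ℝ)

lemma reflect_apply {n : ℕ} (l j : Fin n) (x : Euc n) :
    reflect l x j = reflectSign l j * x j := by
  simp only [reflect, reflectSign]; split_ifs <;> simp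

lemma coe_reflectEquiv {n : ℕ} (l : Fin n) : ⇑(reflectEquiv l) = reflect l := by
  ext x j
  simp only [reflectEquiv, reflect, LinearIsometryEquiv.piLpCongrRight_apply]
  split_ifs <;> simp

lemma reflect_reflect {n : ℕ} (l : Fin n) (x : Euc n) : reflect l (reflect l x) = x := by
  ext j
  rw [reflect_apply, reflect_apply, ← mul_assoc, reflectSign_mul_self, one_mul]

lemma reflect_apply_self {n : ℕ} (l : Fin n) (x : Euc n) : reflect l x l = -x l := by
  simp [reflect_apply, reflectSign]

lemma reflect_eq_self {n : ℕ} {l : Fin n} {x : Euc n} (hx : x l = 0) : reflect l x = x := by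
  ext j
  rw [reflect_apply]
  by_cases hj : j = l
  · subst hj; simp [hx]
  · simp [reflectSign, hj]

lemma reflect_single {n : ℕ} (l k : Fin n) :
    reflect l (EuclideanSpace.single k 1) = reflectSign l k • EuclideanSpace.single k (1 : ℝ) := by
  ext j
  rw [reflect_apply]
  by_cases hj : j = k
  · subst hj; simp
  · simp [hj]

lemma measurePreserving_reflect {n : ℕ} (l : Fin n) :
    MeasurePreserving (reflect l : Euc n → Euc n) := by
  rw [← coe_reflectEquiv]
  exact (reflectEquiv l).measurePreserving

lemma measurableEmbedding_reflect {n : ℕ} (l : Fin n) :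
    MeasurableEmbedding (reflect l : Euc n → Euc n) := by
  rw [← coe_reflectEquiv]
  exact (reflectEquiv l).toHomeomorph.measurableEmbedding

lemma contDiff_reflect {n : ℕ} (l : Fin n) {m : WithTop ℕ∞} :
    ContDiff ℝ m (reflect l : Euc n → Euc n) := by
  rw [← coe_reflectEquiv]
  exact (reflectEquiv l).contDiff

lemma pd_const_mul_comp_reflect {n : ℕ} (l k : Fin n) (c : ℝ) {f : Euc n → ℝ}
    (hf : Differentiable ℝ f) (x : Euc n) :
    pd k (fun z => c * f (reflect l z)) x = c * reflectSign l k * pd k f (reflect l x) := by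
  have hR : HasFDerivAt (reflect l) ((reflectEquiv l).toContinuousLinearEquiv : Euc n →L[ℝ] Euc n)
      x := by
    rw [← coe_reflectEquiv]
    exact (reflectEquiv l).toContinuousLinearEquiv.hasFDerivAt
  have h := ((hf (reflect l x)).hasFDerivAt.comp x hR).const_mul c
  have hs : reflectEquiv l (EuclideanSpace.single k 1)
      = reflectSign l k • EuclideanSpace.single k (1 : ℝ) := by
    rw [coe_reflectEquiv, reflect_single]
  change fderiv ℝ (fun z => c * f (reflect l z)) x _ = _
  erw [h.fderiv]
  simp [hs, pd, mul_assoc]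

lemma contDiff_pd {n : ℕ} (k : Fin n) {f : Euc n → ℝ} (hf : ContDiff ℝ (⊤ : ℕ∞) f) :
    ContDiff ℝ (⊤ : ℕ∞) (pd k f) :=
  (hf.fderiv_right (m := (⊤ : ℕ∞)) (by norm_cast)).clm_apply contDiff_const

lemma hasCompactSupport_pd {n : ℕ} (k : Fin n) {f : Euc n → ℝ} (hf : HasCompactSupport f) :
    HasCompactSupport (pd k f) :=
  hf.fderiv_apply ℝ _

lemma pd_congr {n : ℕ} {k : Fin n} {f g : Euc n → ℝ} {x : Euc n}
    (hfg : f =ᶠ[nhds x] g) : pd k f x = pd k g x := by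
  simp only [pd, hfg.fderiv_eq]

/-- A derivative in a direction tangent to a hyperplane on which the function vanishes is zero. -/
lemma pd_eq_zero_of_eq_zero_on_hyperplane {n : ℕ} {k l : Fin n} (hkl : k ≠ l) {f : Euc n → ℝ}
    (hf : Differentiable ℝ f) (h0 : ∀ x : Euc n, x l = 0 → f x = 0) {x : Euc n} (hx : x l = 0) :
    pd k f x = 0 := by
  have h := (hf x).hasFDerivAt.hasLineDerivAt (EuclideanSpace.single k (1 : ℝ))
  have h' : HasDerivAt (fun t : ℝ => f (x + t • EuclideanSpace.single k (1 : ℝ))) 0 0 := by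
    have : (fun t : ℝ => f (x + t • EuclideanSpace.single k (1 : ℝ))) = fun _ => 0 := by
      funext t
      exact h0 _ (by simp [hx, hkl.symm])
    rw [this]
    exact hasDerivAt_const _ _
  exact HasDerivAt.unique h h'

lemma contDiff_u0_rpow (n : ℕ) (p : ℝ) : ContDiff ℝ (⊤ : ℕ∞) (fun x => u0 n x ^ p) := by
  have hpos : ∀ x : Euc n, 0 < 1 + ‖x‖ ^ 2 := fun x => by positivity
  have hbase : ContDiff ℝ (⊤ : ℕ∞) (fun x : Euc n => 1 / (1 + ‖x‖ ^ 2)) :=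
    contDiff_const.div (contDiff_const.add (contDiff_norm_sq ℝ)) fun x => (hpos x).ne'
  have hb : ∀ x : Euc n, 0 < 1 / (1 + ‖x‖ ^ 2) := fun x => one_div_pos.2 (hpos x)
  exact (hbase.rpow_const_of_ne fun x => (hb x).ne').rpow_const_of_ne
    fun x => (Real.rpow_pos_of_pos (hb x) _).ne'

lemma u0_reflect {n : ℕ} (l : Fin n) (x : Euc n) : u0 n (reflect l x) = u0 n x := by
  simp only [u0, ← coe_reflectEquiv, LinearIsometryEquiv.norm_map]

/-- The divergence theorem on a half-space, for a compactly supported field tangent to the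
boundary. -/
lemma integral_halfSpace_divergence_eq_zero {n : ℕ} (l : Fin n) (F : Fin n → Euc n → ℝ)
    (hF : ∀ k, ContDiff ℝ (⊤ : ℕ∞) (F k)) (hc : ∀ k, HasCompactSupport (F k))
    (h0 : ∀ x : Euc n, x l = 0 → F l x = 0) :
    ∫ x in {x : Euc n | 0 ≤ x l}, ∑ k, pd k (F k) x = 0 := by
  obtain ⟨m, rfl⟩ : ∃ m, n = m + 1 := ⟨n - 1, by have := l.pos; omega⟩
  obtain ⟨M, hM0, hM⟩ : ∃ M : ℝ, 0 < M ∧ ∀ k x, (∃ j, M ≤ |x j|) → x ∉ tsupport (F k) := by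
    have hK : IsCompact (⋃ k, tsupport (F k)) := isCompact_iUnion fun k => hc k
    obtain ⟨r, hr⟩ := hK.isBounded.exists_norm_le
    refine ⟨|r| + 1, by positivity, fun k x ⟨j, hj⟩ hx => ?_⟩
    have h1 := hr x (Set.mem_iUnion.2 ⟨k, hx⟩)
    have h2 : |x j| ≤ ‖x‖ := by simpa using PiLp.norm_apply_le x j
    linarith [le_abs_self r]
  have hF0 : ∀ k x, (∃ j, M ≤ |x j|) → F k x = 0 := fun k x hx =>
    image_eq_zero_of_notMem_tsupport (hM k x hx)
  have hpd0 : ∀ k x, (∃ j, M ≤ |x j|) → pd k (F k) x = 0 := fun k x hx => by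
    have := fderiv_of_notMem_tsupport (𝕜 := ℝ) (hM k x hx)
    simp [pd, this]
  set a : Fin (m + 1) → ℝ := fun j => if j = l then 0 else -M with ha
  set b : Fin (m + 1) → ℝ := fun _ => M with hb
  have hab : a ≤ b := fun j => by simp only [ha, hb]; split_ifs <;> linarith
  let L := (PiLp.continuousLinearEquiv 2 ℝ (fun _ : Fin (m + 1) => ℝ)).symm
  have hdcont : Continuous fun x => ∑ k, pd k (F k) x :=
    continuous_finsetSum _ fun k _ => (contDiff_pd k (hF k)).continuous
  have hdiv := integral_divergence_of_hasFDerivAt_off_countable' a b hab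
    (fun k y => F k (L y))
    (fun k y => (fderiv ℝ (F k) (L y)).comp (L : (Fin (m + 1) → ℝ) →L[ℝ] Euc (m + 1))) ∅
    Set.countable_empty
    (fun k => ((hF k).continuous.comp L.continuous).continuousOn)
    (fun y _ k => (((hF k).differentiable (by simp)) (L y)).hasFDerivAt.comp y L.hasFDerivAt)
    ((hdcont.comp L.continuous).continuousOn.integrableOn_Icc)
  have hfront : ∀ k (y : Fin m → ℝ), F k (L (Fin.insertNth k (b k) y)) = 0 := fun k y =>
    hF0 _ _ ⟨k, by simp [L, hb, le_abs_self]⟩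
  have hback : ∀ k (y : Fin m → ℝ), F k (L (Fin.insertNth k (a k) y)) = 0 := fun k y => by
    by_cases hk : k = l
    · subst hk
      exact h0 _ (by simp [L, ha])
    · exact hF0 _ _ ⟨k, by simp [L, ha, hk, le_abs_self]⟩
  simp only [hfront, hback, integral_zero, sub_zero, Finset.sum_const_zero] at hdiv
  have hmp := (PiLp.volume_preserving_toLp (Fin (m + 1))).setIntegral_preimage_emb
    (MeasurableEquiv.toLp 2 (Fin (m + 1) → ℝ)).measurableEmbedding
    (fun x => ∑ k, pd k (F k) x) {x : Euc (m + 1) | 0 ≤ x l}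
  rw [← hmp]
  refine ((setIntegral_eq_of_subset_of_forall_sdiff_eq_zero (s := Set.Icc a b)
    ?_ ?_ ?_).trans ?_).trans hdiv
  · exact (measurableSet_le measurable_const (measurable_pi_apply l))
  · intro y hy
    simpa [ha] using hy.1 l
  · intro y hy
    refine Finset.sum_eq_zero fun k _ => hpd0 _ _ ?_
    by_contra! hcon
    refine hy.2 ⟨fun j => ?_, fun j => (abs_lt.1 (hcon j)).2.le⟩
    by_cases hj : j = l
    · subst hj
      simpa [ha] using hy.1
    · simpa [ha, hj] using (abs_lt.1 (hcon j)).1.le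
  · simp only [pd]
    rfl

lemma ae_coord_ne_zero {n : ℕ} (l : Fin n) : ∀ᵐ x : Euc n, x l ≠ 0 := by
  let f : Euc n →ₗ[ℝ] ℝ := (EuclideanSpace.proj l : Euc n →L[ℝ] ℝ).toLinearMap
  have h := Measure.addHaar_submodule (volume : Measure (Euc n)) (LinearMap.ker f) (by
    intro htop
    have : EuclideanSpace.single l (1 : ℝ) ∈ LinearMap.ker f := htop ▸ Submodule.mem_top
    simp [f] at this)
  rw [ae_iff]
  convert! h using 2
  ext x
  simp [f]

lemma measurableSet_halfSpace {n : ℕ} (l : Fin n) : MeasurableSet {x : Euc n | 0 ≤ x l} :=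
  measurableSet_le measurable_const (EuclideanSpace.proj (𝕜 := ℝ) l).continuous.measurable

lemma pd_mul {n : ℕ} (k : Fin n) {f g : Euc n → ℝ} (hf : Differentiable ℝ f)
    (hg : Differentiable ℝ g) (x : Euc n) :
    pd k (fun y => f y * g y) x = f x * pd k g x + g x * pd k f x := by
  simp [pd, fderiv_fun_mul (hf x) (hg x)]

lemma pd_add {n : ℕ} (k : Fin n) {f g : Euc n → ℝ} (hf : Differentiable ℝ f)
    (hg : Differentiable ℝ g) (x : Euc n) :
    pd k (fun y => f y + g y) x = pd k f x + pd k g x := by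
  simp [pd, fderiv_fun_add (hf x) (hg x)]

lemma pd_sum {n : ℕ} {ι : Type*} (s : Finset ι) (k : Fin n) {f : ι → Euc n → ℝ}
    (hf : ∀ i, Differentiable ℝ (f i)) (x : Euc n) :
    pd k (fun y => ∑ i ∈ s, f i y) x = ∑ i ∈ s, pd k (f i) x := by
  simp [pd, fderiv_fun_sum fun i _ => hf i x]

/-- A tensor that is divergence-free on a half-space and has vanishing tangential-normal components
on the boundary is orthogonal to the gradients of fields tangent to the boundary. -/
lemma integral_halfSpace_contract_pd_eq_zero {n : ℕ} (l : Fin n) (T : Fin n → Fin n → Euc n → ℝ)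
    (hT : ∀ i k, ContDiff ℝ (⊤ : ℕ∞) (T i k))
    (hdiv : ∀ x : Euc n, 0 ≤ x l → ∀ i, ∑ k, pd k (T i k) x = 0)
    (hbd : ∀ x : Euc n, x l = 0 → ∀ i, i ≠ l → T i l x = 0)
    (Z : Fin n → Euc n → ℝ) (hZ : ∀ i, ContDiff ℝ (⊤ : ℕ∞) (Z i))
    (hZc : ∀ i, HasCompactSupport (Z i)) (hZl : ∀ x : Euc n, x l = 0 → Z l x = 0) :
    ∫ x in {x : Euc n | 0 ≤ x l}, ∑ i, ∑ k, T i k x * pd k (Z i) x = 0 := by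
  have hTd : ∀ i k, Differentiable ℝ (T i k) := fun i k => (hT i k).differentiable (by simp)
  have hZd : ∀ i, Differentiable ℝ (Z i) := fun i => (hZ i).differentiable (by simp)
  have hF : ∀ i k, HasCompactSupport (fun x => T i k x * Z i x) := fun i k => (hZc i).mul_left
  refine Eq.trans ?_ (integral_halfSpace_divergence_eq_zero l (fun k x => ∑ i, T i k x * Z i x)
    (fun k => ContDiff.sum fun i _ => (hT i k).mul (hZ i))
    (fun k => ?_) (fun x hx => Finset.sum_eq_zero fun i _ => ?_))
  · refine setIntegral_congr_fun (measurableSet_halfSpace l) fun x hx => ?_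
    have hsum : ∀ k, pd k (fun y => ∑ i, T i k y * Z i y) x
        = ∑ i, (T i k x * pd k (Z i) x + Z i x * pd k (T i k) x) := fun k => by
      rw [pd_sum _ _ fun i => (hTd i k).fun_mul (hZd i)]
      simp only [pd_mul _ (hTd _ _) (hZd _)]
    simp only [hsum]
    rw [Finset.sum_comm (f := fun k i => T i k x * pd k (Z i) x + Z i x * pd k (T i k) x)]
    simp only [Finset.sum_add_distrib, ← Finset.mul_sum, hdiv x hx, mul_zero, add_zero]
  · refine HasCompactSupport.of_support_subset_isCompact
      (isCompact_iUnion fun i => (hF i k).isCompact) fun x hx => ?_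
    obtain ⟨i, -, hi⟩ := Finset.exists_ne_zero_of_sum_ne_zero hx
    exact Set.mem_iUnion.2 ⟨i, subset_tsupport _ hi⟩
  · by_cases hi : i = l
    · subst hi; simp [hZl x hx]
    · simp [hbd x hx i hi]

lemma integrable_indicator_contract_pd {n : ℕ} (l : Fin n) (T : Fin n → Fin n → Euc n → ℝ)
    (hT : ∀ i k, ContDiff ℝ (⊤ : ℕ∞) (T i k))
    (Z : Fin n → Euc n → ℝ) (hZ : ∀ i, ContDiff ℝ (⊤ : ℕ∞) (Z i))
    (hZc : ∀ i, HasCompactSupport (Z i)) :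
    Integrable ({x : Euc n | 0 ≤ x l}.indicator
      fun x => ∑ i, ∑ k, T i k x * pd k (Z i) x) := by
  refine Integrable.indicator ?_ (measurableSet_halfSpace l)
  refine integrable_finsetSum _ fun i _ => integrable_finsetSum _ fun k _ => ?_
  exact ((hT i k).continuous.mul (contDiff_pd k (hZ i)).continuous).integrable_of_hasCompactSupport
    (hasCompactSupport_pd k (hZc i)).mul_left

/-- A symmetric-parity extension across `{x_l = 0}` of a tensor as in
`integral_halfSpace_contract_pd_eq_zero` is weakly divergence-free on the whole space. -/
lemma integral_reflected_contract_pd_eq_zero {n : ℕ} (l : Fin n) (T : Fin n → Fin n → Euc n → ℝ)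
    (hT : ∀ i k, ContDiff ℝ (⊤ : ℕ∞) (T i k))
    (hdiv : ∀ x : Euc n, 0 ≤ x l → ∀ i, ∑ k, pd k (T i k) x = 0)
    (hbd : ∀ x : Euc n, x l = 0 → ∀ i, i ≠ l → T i l x = 0)
    (S : Fin n → Fin n → Euc n → ℝ)
    (hS : ∀ x : Euc n, 0 < x l → ∀ i k, S i k x = T i k x ∧
      S i k (reflect l x) = reflectSign l i * reflectSign l k * T i k x)
    (W : Fin n → Euc n → ℝ) (hW : ∀ i, ContDiff ℝ (⊤ : ℕ∞) (W i))
    (hWc : ∀ i, HasCompactSupport (W i)) :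
    ∫ x : Euc n, ∑ i, ∑ k, S i k x * pd k (W i) x = 0 := by
  let W' : Fin n → Euc n → ℝ := fun i x => reflectSign l i * W i (reflect l x)
  have hW' : ∀ i, ContDiff ℝ (⊤ : ℕ∞) (W' i) := fun i =>
    contDiff_const.mul ((hW i).comp (contDiff_reflect l))
  have hWc' : ∀ i, HasCompactSupport (W' i) := fun i => by
    have h := (hWc i).comp_homeomorph (reflectEquiv l).toHomeomorph
    have h' : HasCompactSupport (fun x => W i (reflect l x)) := by
      rw [← coe_reflectEquiv]; exact h
    exact h'.mul_left
  have hWd : ∀ i, Differentiable ℝ (W i) := fun i => (hW i).differentiable (by simp)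
  have hWd' : ∀ i, Differentiable ℝ (W' i) := fun i => (hW' i).differentiable (by simp)
  let H : Set (Euc n) := {x | 0 ≤ x l}
  have hH : MeasurableSet H := measurableSet_halfSpace l
  let G : Euc n → ℝ := H.indicator fun x => ∑ i, ∑ k, T i k x * pd k (W i) x
  let G' : Euc n → ℝ := H.indicator fun x => ∑ i, ∑ k, T i k x * pd k (W' i) x
  have hG : Integrable G := integrable_indicator_contract_pd l T hT W hW hWc
  have hG' : Integrable G' := integrable_indicator_contract_pd l T hT W' hW' hWc'
  have hae : (fun x => ∑ i, ∑ k, S i k x * pd k (W i) x) =ᵐ[volume]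
      fun x => G x + G' (reflect l x) := by
    filter_upwards [ae_coord_ne_zero l] with x hx
    rcases lt_or_gt_of_ne hx with hneg | hpos
    · have hy : 0 < reflect l x l := by rw [reflect_apply_self]; linarith
      have h1 : G x = 0 := Set.indicator_of_notMem (by simpa [H] using hneg) _
      have h2 : G' (reflect l x)
          = ∑ i, ∑ k, T i k (reflect l x) * pd k (W' i) (reflect l x) :=
        Set.indicator_of_mem (by simpa [H] using hy.le) _
      rw [h1, h2, zero_add]
      refine Finset.sum_congr rfl fun i _ => Finset.sum_congr rfl fun k _ => ?_
      have h3 := (hS _ hy i k).2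
      rw [reflect_reflect] at h3
      rw [h3, pd_const_mul_comp_reflect l k _ (hWd i), reflect_reflect]
      ring
    · have h1 : G x = ∑ i, ∑ k, T i k x * pd k (W i) x :=
        Set.indicator_of_mem (by simpa [H] using hpos.le) _
      have h2 : G' (reflect l x) = 0 := Set.indicator_of_notMem
        (by simpa [H, reflect_apply_self] using hpos) _
      rw [h1, h2, add_zero]
      exact Finset.sum_congr rfl fun i _ => Finset.sum_congr rfl fun k _ => by
        rw [(hS x hpos i k).1]
  have hmp := measurePreserving_reflect l
  have hme := measurableEmbedding_reflect l
  have hGR : Integrable fun x => G' (reflect l x) := (hmp.integrable_comp_emb hme).2 hG'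
  rw [integral_congr_ae hae, integral_add hG hGR,
    hmp.integral_comp hme, ← integral_add hG hG']
  rw [← integral_halfSpace_contract_pd_eq_zero l T hT hdiv hbd (fun i x => W i x + W' i x)
    (fun i => (hW i).add (hW' i)) (fun i => (hWc i).add (hWc' i))
    (fun x hx => by simp [W', reflectSign, reflect_eq_self hx]), ← integral_indicator hH]
  refine integral_congr_ae (Filter.Eventually.of_forall fun x => ?_)
  by_cases hx : x ∈ H
  · simp only [G, G', Set.indicator_of_mem hx, pd_add _ (hWd _) (hWd' _), mul_add,
      Finset.sum_add_distrib]
  · simp only [G, G', Set.indicator_of_notMem hx, add_zero]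

/-- the reflected vector field `Ṽ` and tensor `h̃` satisfy the weak formulation of
the elliptic system on all of `ℝ^n`. -/
theorem statement19 (n : ℕ) (hn : 3 ≤ n) (l₀ : Fin n) (hl₀ : (l₀ : ℕ) = n - 1)
    (h : Fin n → Fin n → Euc n → ℝ)
    (hsm : ∀ i k, ContDiff ℝ (⊤ : ℕ∞) (h i k))
    (hsupp : ∀ i k, HasCompactSupport (h i k))
    (hsymm : ∀ i k x, h i k x = h k i x)
    (htrace : ∀ x, ∑ i, h i i x = 0)
    (V : Fin n → Euc n → ℝ) (hV : ∀ i, ContDiff ℝ (⊤ : ℕ∞) (V i))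
    (ha : ∀ x : Euc n, 0 ≤ x l₀ → ∀ i,
      ∑ k, pd k (fun y => u0 n y ^ (2 * (n : ℝ) / ((n : ℝ) - 2))
        * (h i k y - pd i (V k) y - pd k (V i) y
            + (2 / (n : ℝ)) * (∑ m, pd m (V m) y) * kd i k)) x = 0)
    (hb : ∀ x : Euc n, x l₀ = 0 →
      V l₀ x = 0 ∧ ∀ i, i ≠ l₀ → pd l₀ (V i) x = h i l₀ x)
    (Vt : Fin n → Euc n → ℝ)
    (ht : Fin n → Fin n → Euc n → ℝ)
    (hVt1 : ∀ x : Euc n, 0 ≤ x l₀ → ∀ i, i ≠ l₀ →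
      Vt i x = V i x ∧ Vt i (reflect l₀ x) = V i x)
    (hVt2 : ∀ x : Euc n, 0 ≤ x l₀ →
      Vt l₀ x = V l₀ x ∧ Vt l₀ (reflect l₀ x) = -V l₀ x)
    (hht1 : ∀ x : Euc n, 0 ≤ x l₀ → ∀ i k, i ≠ l₀ → k ≠ l₀ →
      ht i k x = h i k x ∧ ht i k (reflect l₀ x) = h i k x)
    (hht2 : ∀ x : Euc n, 0 ≤ x l₀ → ∀ i, i ≠ l₀ →
      (ht i l₀ x = h i l₀ x ∧ ht i l₀ (reflect l₀ x) = -h i l₀ x)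
        ∧ (ht l₀ i x = h l₀ i x ∧ ht l₀ i (reflect l₀ x) = -h l₀ i x))
    (hht3 : ∀ x : Euc n, 0 ≤ x l₀ →
      ht l₀ l₀ x = h l₀ l₀ x ∧ ht l₀ l₀ (reflect l₀ x) = h l₀ l₀ x) :
    ∀ W : Fin n → Euc n → ℝ, (∀ i, ContDiff ℝ (⊤ : ℕ∞) (W i)) → (∀ i, HasCompactSupport (W i)) →
      ∫ x : Euc n, u0 n x ^ (2 * (n : ℝ) / ((n : ℝ) - 2))
        * ∑ i, ∑ k, (ht i k x - pd i (Vt k) x - pd k (Vt i) x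
            + (2 / (n : ℝ)) * (∑ m, pd m (Vt m) x) * kd i k) * pd k (W i) x = 0 := by
  intro W hW hWc
  let p : ℝ := 2 * (n : ℝ) / ((n : ℝ) - 2)
  have hVd : ∀ i, Differentiable ℝ (V i) := fun i => (hV i).differentiable (by simp)
  have hρ := contDiff_u0_rpow n p
  have hT : ∀ i k, ContDiff ℝ (⊤ : ℕ∞) (fun y => u0 n y ^ p
        * (h i k y - pd i (V k) y - pd k (V i) y
            + (2 / (n : ℝ)) * (∑ m, pd m (V m) y) * kd i k)) := fun i k =>
    hρ.mul ((((hsm i k).sub (contDiff_pd i (hV k))).sub (contDiff_pd k (hV i))).add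
      ((contDiff_const.mul (ContDiff.sum fun m _ => contDiff_pd m (hV m))).mul contDiff_const))
  have hVt : ∀ x : Euc n, 0 ≤ x l₀ → ∀ i, Vt i x = V i x ∧
      Vt i (reflect l₀ x) = reflectSign l₀ i * V i x := fun x hx i => by
    by_cases hi : i = l₀
    · subst hi; simpa [reflectSign] using hVt2 x hx
    · simpa [reflectSign, hi] using hVt1 x hx i hi
  have hht : ∀ x : Euc n, 0 ≤ x l₀ → ∀ i k, ht i k x = h i k x ∧
      ht i k (reflect l₀ x) = reflectSign l₀ i * reflectSign l₀ k * h i k x := fun x hx i k => by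
    by_cases hi : i = l₀ <;> by_cases hk : k = l₀
    · subst hi; subst hk; simpa [reflectSign] using hht3 x hx
    · subst hi; simpa [reflectSign, hk] using (hht2 x hx k hk).2
    · subst hk; simpa [reflectSign, hi] using (hht2 x hx i hi).1
    · simpa [reflectSign, hi, hk] using hht1 x hx i k hi hk
  have hcoord : Continuous fun y : Euc n => y l₀ := (EuclideanSpace.proj l₀).continuous
  have hpd : ∀ x : Euc n, 0 < x l₀ → ∀ i k, pd k (Vt i) x = pd k (V i) x ∧
      pd k (Vt i) (reflect l₀ x) = reflectSign l₀ i * reflectSign l₀ k * pd k (V i) x := by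
    intro x hx i k
    constructor
    · refine pd_congr ?_
      filter_upwards [hcoord.continuousAt.eventually (lt_mem_nhds hx)] with y hy
      exact (hVt y hy.le i).1
    · have hev : Vt i =ᶠ[nhds (reflect l₀ x)]
          fun z => reflectSign l₀ i * V i (reflect l₀ z) := by
        have hneg : reflect l₀ x l₀ < 0 := by rw [reflect_apply_self]; linarith
        filter_upwards [hcoord.continuousAt.eventually (gt_mem_nhds hneg)] with z hz
        have hz' : 0 ≤ reflect l₀ z l₀ := by rw [reflect_apply_self]; linarith
        simpa [reflect_reflect] using (hVt _ hz' i).2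
      rw [pd_congr hev, pd_const_mul_comp_reflect l₀ k _ (hVd i), reflect_reflect]
  have key := integral_reflected_contract_pd_eq_zero l₀ _ hT ha ?_
    (fun i k x => u0 n x ^ p * (ht i k x - pd i (Vt k) x - pd k (Vt i) x
            + (2 / (n : ℝ)) * (∑ m, pd m (Vt m) x) * kd i k)) ?_ W hW hWc
  · rw [← key]
    simp only [Finset.mul_sum, mul_assoc, p]
  · intro x hx i hi
    simp [(hb x hx).2 i hi, kd, hi,
      pd_eq_zero_of_eq_zero_on_hyperplane hi (hVd l₀) (fun y hy => (hb y hy).1) hx]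
  · intro x hx i k
    refine ⟨?_, ?_⟩
    · simp only [(hht x hx.le _ _).1, (hpd x hx _ _).1]
    · simp only [(hht x hx.le _ _).2, (hpd x hx _ _).2, u0_reflect, reflectSign_mul_self, one_mul]
      by_cases hik : i = k
      · subst hik
        simp only [reflectSign_mul_self, one_mul]
      · simp only [kd, hik, if_false]
        ring
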